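/- Let α ∈ (1,2) and θ ∈ (0, 2π). Then the series S = ∑_{k=1}^{∞} cos(kθ) Γ(k+1−α)/Γ(k+2) converges, and α − cos θ − (α(α−1)/Γ(2−α)) · S = (2 sin(θ/2))^α · cos( (θ − π)(1 − α/2) ). -/

import Mathlib

open Real

/-- The coefficients `Γ(k+2−α)/Γ(k+3)` are summable, by telescoping `Γ(k+2−α)/Γ(k+2)`. -/
theorem summable_Gamma_div_Gamma {α : ℝ} (h0 : 0 < α) (h2 : α < 2) :
    Summable fun k : ℕ => Real.Gamma (k + 2 - α) / Real.Gamma (k + 3) := by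
  have hpos : ∀ k : ℕ, 0 < (k : ℝ) + 2 - α := fun k => by
    have := k.cast_nonneg (α := ℝ)
    linarith
  have hsum : ∀ n : ℕ,
      ∑ k ∈ Finset.range n, Real.Gamma (k + 2 - α) / Real.Gamma (k + 3) =
        (Real.Gamma (2 - α) - Real.Gamma (n + 2 - α) / Real.Gamma (n + 2)) / α := by
    intro n
    induction n with
    | zero => simp
    | succ n ih =>
      have h3 : Real.Gamma ((n : ℝ) + 3) = (n + 2) * Real.Gamma (n + 2) := by
        rw [← Real.Gamma_add_one (by positivity)]
        ring_nf
      have h4 : Real.Gamma (((n + 1 : ℕ) : ℝ) + 2 - α) =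
          (n + 2 - α) * Real.Gamma (n + 2 - α) := by
        rw [← Real.Gamma_add_one (hpos n).ne']
        push_cast
        ring_nf
      have h5 : Real.Gamma (((n + 1 : ℕ) : ℝ) + 2) = (n + 2) * Real.Gamma (n + 2) := by
        rw [← h3]
        push_cast
        ring_nf
      have h6 : Real.Gamma ((n : ℝ) + 2) ≠ 0 := (Real.Gamma_pos_of_pos (by positivity)).ne'
      have h7 : (n : ℝ) + 2 ≠ 0 := by positivity
      rw [Finset.sum_range_succ, ih, h3, h4, h5]
      field_simp
      ring
  refine summable_of_sum_range_le (c := Real.Gamma (2 - α) / α) (fun k => ?_) (fun n => ?_)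
  · exact div_nonneg (Real.Gamma_pos_of_pos (hpos k)).le
      (Real.Gamma_pos_of_pos (by positivity)).le
  · rw [hsum]
    gcongr
    exact sub_le_self _ (div_nonneg (Real.Gamma_pos_of_pos (hpos n)).le
      (Real.Gamma_pos_of_pos (by positivity)).le)

theorem Ring.choose_succ_mul {K : Type*} [Field K] [CharZero K] (a : K) (n : ℕ) :
    Ring.choose a (n + 1) * (n + 1) = Ring.choose a n * (a - n) := by
  have h : ((n.factorial : ℕ) : K) ≠ 0 := by exact_mod_cast n.factorial_ne_zero
  have h' : (n : K) + 1 ≠ 0 := by exact_mod_cast n.succ_ne_zero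
  simp only [Ring.choose_eq_smul, descPochhammer_succ_right, Nat.factorial_succ,
    Polynomial.smeval_mul, Polynomial.smeval_sub, Polynomial.smeval_X,
    Polynomial.smeval_natCast, smul_eq_mul]
  push_cast
  field_simp
  simp

theorem neg_one_pow_mul_choose_add_two {α : ℝ} (h2 : α < 2) (k : ℕ) :
    (-1) ^ k * Ring.choose α (k + 2) =
      α * (α - 1) / Real.Gamma (2 - α) * (Real.Gamma (k + 2 - α) / Real.Gamma (k + 3)) := by
  induction k with
  | zero =>
    have h := Ring.choose_succ_mul α 1
    have hG : Real.Gamma (2 - α) ≠ 0 := (Real.Gamma_pos_of_pos (by linarith)).ne'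
    have h3 : Real.Gamma 3 = 2 := by
      simp [Nat.factorial]
    rw [Ring.choose_one_right] at h
    norm_num at h
    simp only [pow_zero, one_mul, zero_add, Nat.cast_zero, h3]
    field_simp
    linarith
  | succ k ih =>
    have h := Ring.choose_succ_mul α (k + 2)
    have h3 : Real.Gamma (((k + 1 : ℕ) : ℝ) + 3) = (k + 3) * Real.Gamma (k + 3) := by
      rw [← Real.Gamma_add_one (by positivity)]
      push_cast
      ring_nf
    have hpos : 0 < (k : ℝ) + 2 - α := by
      have := k.cast_nonneg (α := ℝ)
      linarith
    have h4 : Real.Gamma (((k + 1 : ℕ) : ℝ) + 2 - α) =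
        (k + 2 - α) * Real.Gamma (k + 2 - α) := by
      rw [← Real.Gamma_add_one hpos.ne']
      push_cast
      ring_nf
    have h7 : (k : ℝ) + 3 ≠ 0 := by positivity
    have h8 : (-1) ^ (k + 1) * Ring.choose α (k + 1 + 2) =
        (-1) ^ k * Ring.choose α (k + 2) * ((k + 2 - α) / (k + 3)) := by
      rw [show k + 1 + 2 = k + 2 + 1 by ring, ← mul_div_assoc, eq_div_iff h7]
      push_cast at h
      linear_combination (-1) ^ (k + 1) * h
    rw [h8, ih, h3, h4, mul_comm ((k : ℝ) + 2 - α), mul_comm ((k : ℝ) + 3), mul_div_mul_comm,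
      mul_assoc]

theorem one_sub_cpow_hasSum {z : ℂ} (hz : ‖z‖ < 1) (a : ℂ) :
    HasSum (fun k : ℕ => (-1) ^ k * Ring.choose a k * z ^ k) ((1 - z) ^ a) := by
  have h := (Complex.one_add_cpow_hasFPowerSeriesOnBall_zero (a := a)).hasSum (y := -z)
    (by
      rw [Metric.mem_eball, edist_zero_right, enorm_neg, ← ofReal_norm]
      exact ENNReal.ofReal_lt_one.2 hz)
  rw [zero_add, ← sub_eq_add_neg] at h
  refine h.congr_fun ?_
  intro k
  rw [binomialSeries_apply, List.ofFn_const, List.prod_replicate, neg_pow, smul_eq_mul]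
  ring

theorem one_sub_cpow_eq_of_norm_lt_one {α : ℝ} (h2 : α < 2) {z : ℂ} (hz : ‖z‖ < 1) :
    (1 - z) ^ (α : ℂ) = 1 - α * z + z ^ 2 * ((α * (α - 1) / Real.Gamma (2 - α) : ℝ) *
      ∑' k : ℕ, ((Real.Gamma (k + 2 - α) / Real.Gamma (k + 3) : ℝ) : ℂ) * z ^ k) := by
  have h := one_sub_cpow_hasSum hz α
  rw [← h.tsum_eq, ← h.summable.sum_add_tsum_nat_add 2, ← tsum_mul_left, ← tsum_mul_left]
  congr 1
  · simp [Finset.sum_range_succ]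
    ring
  · refine tsum_congr fun k => ?_
    rw [← Complex.ofReal_choose]
    have hk := congrArg (fun x : ℝ => (x : ℂ)) (neg_one_pow_mul_choose_add_two h2 k)
    push_cast at hk ⊢
    linear_combination z ^ (k + 2) * hk

theorem one_sub_cpow_eq_of_norm_eq_one {α : ℝ} (h0 : 0 < α) (h2 : α < 2) {z : ℂ}
    (hz : ‖z‖ = 1) (hz1 : z ≠ 1) :
    (1 - z) ^ (α : ℂ) = 1 - α * z + z ^ 2 * ((α * (α - 1) / Real.Gamma (2 - α) : ℝ) *
      ∑' k : ℕ, ((Real.Gamma (k + 2 - α) / Real.Gamma (k + 3) : ℝ) : ℂ) * z ^ k) := by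
  have hcont : ContinuousOn (fun w : ℂ =>
      ∑' k : ℕ, ((Real.Gamma (k + 2 - α) / Real.Gamma (k + 3) : ℝ) : ℂ) * w ^ k)
      (Metric.closedBall 0 1) := by
    refine continuousOn_tsum (fun k => by fun_prop) (summable_Gamma_div_Gamma h0 h2).norm ?_
    intro k w hw
    rw [norm_mul, Complex.norm_real, norm_pow]
    exact mul_le_of_le_one_right (norm_nonneg _)
      (pow_le_one₀ (norm_nonneg _) (by simpa using hw))
  have hslit : 1 - z ∈ Complex.slitPlane := by
    left
    have hre : z.re < 1 := lt_of_le_of_ne (hz ▸ Complex.re_le_norm z) fun hre => hz1 <| by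
      have hsq := Complex.sq_norm_sub_sq_re z
      rw [hz, hre] at hsq
      exact Complex.ext hre (by simpa using hsq.symm)
    simpa using hre
  have hmem : z ∈ closure (Metric.ball (0 : ℂ) 1) := by
    rw [closure_ball _ one_ne_zero]
    simp [hz]
  have : (nhdsWithin z (Metric.ball (0 : ℂ) 1)).NeBot := mem_closure_iff_nhdsWithin_neBot.1 hmem
  have hl : Filter.Tendsto (fun w : ℂ => (1 - w) ^ (α : ℂ))
      (nhdsWithin z (Metric.ball (0 : ℂ) 1)) (nhds ((1 - z) ^ (α : ℂ))) :=
    (ContinuousAt.cpow (by fun_prop) (by fun_prop) hslit).tendsto.mono_left nhdsWithin_le_nhds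
  have hr : ContinuousOn (fun z : ℂ => 1 - α * z + z ^ 2 *
      ((α * (α - 1) / Real.Gamma (2 - α) : ℝ) *
      ∑' k : ℕ, ((Real.Gamma (k + 2 - α) / Real.Gamma (k + 3) : ℝ) : ℂ) * z ^ k))
      (Metric.closedBall 0 1) := by fun_prop
  refine tendsto_nhds_unique hl (((hr z (by simp [hz])).mono
    Metric.ball_subset_closedBall).tendsto.congr' ?_)
  filter_upwards [self_mem_nhdsWithin] with w hw
  exact (one_sub_cpow_eq_of_norm_lt_one h2 (by simpa using hw)).symm

theorem one_sub_exp_mul_I (θ : ℝ) :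
    1 - Complex.exp (θ * Complex.I) =
      (2 * Real.sin (θ / 2) : ℝ) * Complex.exp (((θ - π) / 2 : ℝ) * Complex.I) := by
  have hc : Real.cos θ = 1 - 2 * Real.sin (θ / 2) ^ 2 := by
    rw [← Real.cos_sq_add_sin_sq (θ / 2), show θ = 2 * (θ / 2) by ring, Real.cos_two_mul']
    ring_nf
  have hs : Real.sin θ = 2 * Real.sin (θ / 2) * Real.cos (θ / 2) := by
    rw [← Real.sin_two_mul]
    ring_nf
  have hφ : (θ - π) / 2 = θ / 2 - π / 2 := by ring
  apply Complex.ext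
  · rw [Complex.re_ofReal_mul, Complex.exp_ofReal_mul_I_re, Complex.sub_re,
      Complex.exp_ofReal_mul_I_re, hc, hφ, Real.cos_sub_pi_div_two, Complex.one_re]
    ring
  · rw [Complex.im_ofReal_mul, Complex.exp_ofReal_mul_I_im, Complex.sub_im,
      Complex.exp_ofReal_mul_I_im, hs, hφ, Real.sin_sub_pi_div_two, Complex.one_im]
    ring

theorem ofReal_mul_exp_mul_I_cpow {r φ : ℝ} (hr : 0 < r) (hφ : φ ∈ Set.Ioc (-π) π) (α : ℝ) :
    ((r : ℂ) * Complex.exp (φ * Complex.I)) ^ (α : ℂ) =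
      (r ^ α : ℝ) * Complex.exp ((α * φ : ℝ) * Complex.I) := by
  rw [Complex.cpow_def_of_ne_zero (mul_ne_zero (by exact_mod_cast hr.ne') (Complex.exp_ne_zero _)),
    Complex.log_ofReal_mul hr (Complex.exp_ne_zero _),
    Complex.log_exp (by simpa using hφ.1) (by simpa using hφ.2), Real.rpow_def_of_pos hr,
    Complex.ofReal_exp, ← Complex.exp_add]
  push_cast
  ring_nf

/-- For `α ∈ (1,2)` and `θ ∈ (0,2π)`, the series `S = ∑_{k=1}^∞ cos(kθ) Γ(k+1−α)/Γ(k+2)`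
converges and `α − cos θ − (α(α−1)/Γ(2−α)) S = (2 sin(θ/2))^α cos((θ−π)(1−α/2))`. -/
theorem stmt8 (α θ : ℝ) (hα : α ∈ Set.Ioo (1 : ℝ) 2)
    (hθ : θ ∈ Set.Ioo (0 : ℝ) (2 * Real.pi)) :
    ∃ S : ℝ,
      HasSum (fun k : ℕ =>
        Real.cos (((k : ℝ) + 1) * θ) *
          (Real.Gamma (((k : ℝ) + 1) + 1 - α) / Real.Gamma (((k : ℝ) + 1) + 2))) S ∧
      α - Real.cos θ - (α * (α - 1) / Real.Gamma (2 - α)) * S =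
        (2 * Real.sin (θ / 2)) ^ α * Real.cos ((θ - Real.pi) * (1 - α / 2)) := by
  obtain ⟨h1, h2⟩ := hα
  obtain ⟨hθ0, hθ1⟩ := hθ
  have h0 : 0 < α := by linarith
  set z : ℂ := Complex.exp (θ * Complex.I) with hz
  have hnorm : ‖z‖ = 1 := Complex.norm_exp_ofReal_mul_I θ
  have hsin : 0 < 2 * Real.sin (θ / 2) := by
    have := Real.sin_pos_of_pos_of_lt_pi (x := θ / 2) (by linarith) (by linarith)
    linarith
  have hsub := one_sub_exp_mul_I θ
  have hz1 : z ≠ 1 := by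
    intro h
    rw [← hz, h, sub_self, eq_comm, mul_eq_zero] at hsub
    exact hsub.elim (by exact_mod_cast hsin.ne') (Complex.exp_ne_zero _)
  have hsummable : Summable fun k : ℕ =>
      ((Real.Gamma (k + 2 - α) / Real.Gamma (k + 3) : ℝ) : ℂ) * z ^ k := by
    refine (summable_Gamma_div_Gamma h0 h2).norm.of_norm_bounded fun k => ?_
    rw [norm_mul, norm_pow, hnorm, one_pow, mul_one, Complex.norm_real]
  have hmain := one_sub_cpow_eq_of_norm_eq_one h0 h2 hnorm hz1
  rw [hz, hsub, ofReal_mul_exp_mul_I_cpow hsin ⟨by linarith, by linarith⟩, ← hz] at hmain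
  set T := ∑' k : ℕ, ((Real.Gamma (k + 2 - α) / Real.Gamma (k + 3) : ℝ) : ℂ) * z ^ k with hT
  refine ⟨(z * T).re, ?_, ?_⟩
  · refine (Complex.hasSum_re (hsummable.hasSum.mul_left z)).congr_fun fun k => ?_
    have hpow : z * (((Real.Gamma (k + 2 - α) / Real.Gamma (k + 3) : ℝ) : ℂ) * z ^ k) =
        ((Real.Gamma (k + 2 - α) / Real.Gamma (k + 3) : ℝ) : ℂ) *
          Complex.exp ((((k : ℝ) + 1) * θ : ℝ) * Complex.I) := by
      rw [mul_left_comm, ← pow_succ', hz, ← Complex.exp_nat_mul]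
      push_cast
      ring_nf
    rw [hpow, Complex.re_ofReal_mul, Complex.exp_ofReal_mul_I_re, mul_comm]
    ring_nf
  · have hinv : Complex.exp ((-θ : ℝ) * Complex.I) * z = 1 := by
      rw [hz, ← Complex.exp_add]
      simp
    have hmul : ((2 * Real.sin (θ / 2)) ^ α : ℝ) *
        Complex.exp ((α * ((θ - π) / 2) - θ : ℝ) * Complex.I) =
        Complex.exp ((-θ : ℝ) * Complex.I) - (α : ℝ) +
          (α * (α - 1) / Real.Gamma (2 - α) : ℝ) * (z * T) := by
      have hexp : Complex.exp ((α * ((θ - π) / 2) - θ : ℝ) * Complex.I) =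
          Complex.exp ((α * ((θ - π) / 2) : ℝ) * Complex.I) *
            Complex.exp ((-θ : ℝ) * Complex.I) := by
        rw [← Complex.exp_add]
        push_cast
        ring_nf
      rw [hexp]
      linear_combination Complex.exp ((-θ : ℝ) * Complex.I) * hmain +
        ((α * (α - 1) / Real.Gamma (2 - α) : ℝ) * (z * T) - α) * hinv
    have hre := congrArg Complex.re hmul
    rw [Complex.re_ofReal_mul, Complex.exp_ofReal_mul_I_re, Complex.add_re, Complex.sub_re,
      Complex.re_ofReal_mul, Complex.exp_ofReal_mul_I_re, Complex.ofReal_re, Real.cos_neg] at hre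
    have hcos : Real.cos ((θ - π) * (1 - α / 2)) = -Real.cos (α * ((θ - π) / 2) - θ) := by
      rw [← Real.cos_add_pi, ← Real.cos_neg]
      ring_nf
    rw [hcos]
    linarith
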